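/- Let n ≥ 1, 1 < p < ∞, 0 < q < p−1, and 0 < α < n/p. There exists a constant C = C(α,p,q,n) > 0 such that for every locally finite nonnegative Borel measure σ on ℝⁿ and every x ∈ ℝⁿ, K_{α,p,q}σ(x) ≥ C · ∫₀^∞ ( σ(B(x,ρ)) / ρ^{n−αp} )^{1/(p−1−q)} dρ/ρ. -/

import Mathlib

open MeasureTheory Metric Set
open scoped ENNReal NNReal

/-- The Wolff potential `W_{α,p}ν(x) = ∫₀^∞ (ν(B(x,ρ))/ρ^{n−αp})^{1/(p−1)} dρ/ρ`. -/
noncomputable def wolffPot (n : ℕ) (α p : ℝ)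
    (ν : Measure (EuclideanSpace ℝ (Fin n))) (x : EuclideanSpace ℝ (Fin n)) : ℝ≥0∞ :=
  ∫⁻ ρ in Set.Ioi (0 : ℝ),
    (ν (Metric.ball x ρ) / ENNReal.ofReal (ρ ^ ((n : ℝ) - α * p))) ^ (1 / (p - 1)) /
      ENNReal.ofReal ρ

/-- The least constant `κ(E)` such that
`(∫_E (W_{α,p}ν)^q dσ)^{1/q} ≤ κ · ν(ℝⁿ)^{1/(p−1)}` for all finite measures `ν`. -/
noncomputable def embC (n : ℕ) (α p q : ℝ) (σ : Measure (EuclideanSpace ℝ (Fin n)))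
    (E : Set (EuclideanSpace ℝ (Fin n))) : ℝ≥0∞ :=
  sInf {κ : ℝ≥0∞ | ∀ ν : Measure (EuclideanSpace ℝ (Fin n)), IsFiniteMeasure ν →
    (∫⁻ y in E, wolffPot n α p ν y ^ q ∂σ) ^ (1 / q) ≤ κ * (ν Set.univ) ^ (1 / (p - 1))}

/-- The intrinsic potential of Wolff type
`K_{α,p,q}σ(x) = ∫₀^∞ (κ(B(x,ρ))^{q(p−1)/(p−1−q)}/ρ^{n−αp})^{1/(p−1)} dρ/ρ`. -/
noncomputable def intK (n : ℕ) (α p q : ℝ) (σ : Measure (EuclideanSpace ℝ (Fin n)))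
    (x : EuclideanSpace ℝ (Fin n)) : ℝ≥0∞ :=
  ∫⁻ ρ in Set.Ioi (0 : ℝ),
    (embC n α p q σ (Metric.ball x ρ) ^ (q * (p - 1) / (p - 1 - q)) /
      ENNReal.ofReal (ρ ^ ((n : ℝ) - α * p))) ^ (1 / (p - 1)) / ENNReal.ofReal ρ

/-- Lower bound for the Wolff potential of a Dirac mass on a ball around its atom. -/
theorem le_wolffPot_dirac {n : ℕ} {α p r : ℝ} (hp : 1 < p) (hαp : 0 < (n : ℝ) - α * p)
    (hr : 0 < r) {x y : EuclideanSpace ℝ (Fin n)} (hy : y ∈ Metric.ball x r) :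
    ENNReal.ofReal ((p - 1) / (n - α * p) * r ^ (-((n - α * p) / (p - 1)))) ≤
      wolffPot n α p (Measure.dirac x) y := by
  have ha : 0 < p - 1 := by linarith
  set s : ℝ := (n : ℝ) - α * p with hs
  have hsa : 0 < s / (p - 1) := by positivity
  have hlt : -(s / (p - 1)) - 1 < -1 := by linarith
  have hint : ∫ ρ in Set.Ioi r, ρ ^ (-(s / (p - 1)) - 1) =
      (p - 1) / s * r ^ (-(s / (p - 1))) := by
    rw [integral_Ioi_rpow_of_lt hlt hr, sub_add_cancel]
    field_simp
  calc ENNReal.ofReal ((p - 1) / s * r ^ (-(s / (p - 1))))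
      = ∫⁻ ρ in Set.Ioi r, ENNReal.ofReal (ρ ^ (-(s / (p - 1)) - 1)) := by
        rw [← hint, ofReal_integral_eq_lintegral_ofReal
          (integrableOn_Ioi_rpow_of_lt hlt hr)]
        filter_upwards [ae_restrict_mem measurableSet_Ioi] with ρ hρ
        exact Real.rpow_nonneg (hr.trans hρ).le _
    _ ≤ ∫⁻ ρ in Set.Ioi r, (Measure.dirac x (Metric.ball y ρ) / ENNReal.ofReal (ρ ^ s)) ^
          (1 / (p - 1)) / ENNReal.ofReal ρ := by
        refine setLIntegral_mono_ae' measurableSet_Ioi (ae_of_all _ fun ρ hρ => ?_)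
        have hρ0 : 0 < ρ := hr.trans hρ
        have hx : x ∈ Metric.ball y ρ := by
          rw [Metric.mem_ball, dist_comm]
          exact (Metric.mem_ball.1 hy).trans hρ
        rw [Measure.dirac_apply_of_mem hx, one_div,
          ← ENNReal.ofReal_inv_of_pos (by positivity),
          ENNReal.ofReal_rpow_of_pos (by positivity),
          ← ENNReal.ofReal_div_of_pos hρ0, ← Real.rpow_neg hρ0.le, ← Real.rpow_mul hρ0.le,
          Real.rpow_sub_one hρ0.ne']
        exact le_of_eq (by congr 3; ring)
    _ ≤ wolffPot n α p (Measure.dirac x) y :=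
        lintegral_mono_set (Set.Ioi_subset_Ioi hr.le)

/-- Testing the embedding constant of a ball against the Dirac mass at its center. -/
theorem le_embC_ball {n : ℕ} {α p q r : ℝ} (hp : 1 < p) (hq : 0 < q)
    (hαp : 0 < (n : ℝ) - α * p) (hr : 0 < r) (σ : Measure (EuclideanSpace ℝ (Fin n)))
    (x : EuclideanSpace ℝ (Fin n)) :
    ENNReal.ofReal ((p - 1) / (n - α * p) * r ^ (-((n - α * p) / (p - 1)))) *
        σ (Metric.ball x r) ^ (1 / q) ≤ embC n α p q σ (Metric.ball x r) := by
  refine le_sInf fun κ hκ => ?_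
  have h := hκ (Measure.dirac x) inferInstance
  rw [measure_univ, ENNReal.one_rpow, mul_one] at h
  refine le_trans ?_ h
  set w := ENNReal.ofReal ((p - 1) / (n - α * p) * r ^ (-((n - α * p) / (p - 1))))
  calc w * σ (Metric.ball x r) ^ (1 / q)
      = (∫⁻ _ in Metric.ball x r, w ^ q ∂σ) ^ (1 / q) := by
        rw [setLIntegral_const, ENNReal.mul_rpow_of_nonneg _ _ (by positivity),
          ← ENNReal.rpow_mul, mul_one_div_cancel hq.ne', ENNReal.rpow_one]
    _ ≤ (∫⁻ y in Metric.ball x r, wolffPot n α p (Measure.dirac x) y ^ q ∂σ) ^ (1 / q) := by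
        gcongr ?_ ^ _
        refine setLIntegral_mono_ae' measurableSet_ball (ae_of_all _ fun y hy => ?_)
        gcongr
        exact le_wolffPot_dirac hp hαp hr hy

/-- There is `C = C(α,p,q,n) > 0` such that
`K_{α,p,q}σ(x) ≥ C ∫₀^∞ (σ(B(x,ρ))/ρ^{n−αp})^{1/(p−1−q)} dρ/ρ`. -/
theorem intK_ge_wolff_type_integral (n : ℕ) (hn : 1 ≤ n) (α p q : ℝ)
    (hp : 1 < p) (hq0 : 0 < q) (hqp : q < p - 1)
    (hα0 : 0 < α) (hαp : α < n / p) :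
    ∃ C : ℝ, 0 < C ∧
      ∀ σ : Measure (EuclideanSpace ℝ (Fin n)), IsLocallyFiniteMeasure σ →
        ∀ x : EuclideanSpace ℝ (Fin n),
          ENNReal.ofReal C *
            (∫⁻ ρ in Set.Ioi (0 : ℝ),
              (σ (Metric.ball x ρ) / ENNReal.ofReal (ρ ^ ((n : ℝ) - α * p))) ^
                  (1 / (p - 1 - q)) / ENNReal.ofReal ρ) ≤
            intK n α p q σ x := by
  have hp0 : 0 < p := by linarith
  have hs : 0 < (n : ℝ) - α * p := by
    have := (lt_div_iff₀ hp0).1 hαp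
    linarith
  have ha : 0 < p - 1 := by linarith
  have haq : 0 < p - 1 - q := by linarith
  refine ⟨((p - 1) / (n - α * p)) ^ (q / (p - 1 - q)), by positivity, fun σ _ x => ?_⟩
  rw [intK, ← lintegral_const_mul' _ _ ENNReal.ofReal_ne_top]
  refine setLIntegral_mono_ae' measurableSet_Ioi (ae_of_all _ fun ρ (hρ : 0 < ρ) => ?_)
  have hκ := le_embC_ball hp hq0 hs hρ σ x
  set s : ℝ := (n : ℝ) - α * p
  set S := σ (Metric.ball x ρ)
  calc _ = ((ENNReal.ofReal ((p - 1) / s * ρ ^ (-(s / (p - 1)))) * S ^ (1 / q)) ^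
          (q * (p - 1) / (p - 1 - q)) / ENNReal.ofReal (ρ ^ s)) ^ (1 / (p - 1)) /
            ENNReal.ofReal ρ := by
        rw [← mul_div_assoc]
        congr 1
        simp only [div_eq_mul_inv _ (ENNReal.ofReal _)]
        rw [← ENNReal.ofReal_inv_of_pos (by positivity), ← Real.rpow_neg hρ.le,
          ENNReal.mul_rpow_of_nonneg _ _ (by positivity),
          ENNReal.mul_rpow_of_nonneg _ _ (by positivity),
          ENNReal.mul_rpow_of_nonneg _ _ (by positivity),
          ENNReal.mul_rpow_of_nonneg _ _ (by positivity),
          ← ENNReal.rpow_mul, ← ENNReal.rpow_mul, ← ENNReal.rpow_mul]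
        have hexp : 1 / q * (q * (p - 1) / (p - 1 - q) * (1 / (p - 1))) =
            1 / (p - 1 - q) := by
          field_simp
        have hexp' : q * (p - 1) / (p - 1 - q) * (1 / (p - 1)) = q / (p - 1 - q) := by
          field_simp
        rw [hexp, hexp',
          ENNReal.ofReal_rpow_of_pos (by positivity), ENNReal.ofReal_rpow_of_pos (by positivity),
          ENNReal.ofReal_rpow_of_pos (by positivity), mul_left_comm, mul_comm _ (S ^ _),
          mul_assoc, ← ENNReal.ofReal_mul (by positivity), ← ENNReal.ofReal_mul (by positivity),
          Real.mul_rpow (by positivity) (by positivity), mul_assoc, ← Real.rpow_mul hρ.le,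
          ← Real.rpow_mul hρ.le, ← Real.rpow_mul hρ.le, ← Real.rpow_add hρ]
        congr 4
        field_simp
        ring
    _ ≤ _ := by gcongr
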